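/- Existence of a characteristic-type vector for trees: let Γ be a finite tree with vertex set {1, …, s}, let m₁, …, m_s be arbitrary integers, let M be the s × s matrix with M_{ii} = m_i, M_{ij} = 1 if i and j are adjacent in Γ, and 0 otherwise, and let δ = (deg(1), …, deg(s)) be the vector of vertex degrees. Then there exists a vector b ∈ ℤˢ such that M b ≡ δ (mod 2), i.e., every coordinate of M b − δ is even. Equivalently, (2ℤˢ + δ) ∩ M·ℤˢ ≠ ∅. -/

import Mathlib

/-- A kernel vector of `diag d + A` over `ZMod 2` is orthogonal to the degree vector. -/
theorem kernel_orthogonal_degree (s : ℕ) (G : SimpleGraph (Fin s))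
    [DecidableRel G.Adj] (d x : Fin s → ZMod 2)
    (hx : ∀ i, d i * x i + ∑ j, (if G.Adj i j then 1 else 0) * x j = 0) :
    ∑ i, (G.degree i : ZMod 2) * x i = 0 := by
  have sq : ∀ a : ZMod 2, a * a = a := by decide
  have dbl : ∀ a : ZMod 2, a + a = 0 := by decide
  have h1 : ∑ i, (G.degree i : ZMod 2) * x i
      = ∑ i, ∑ j, (if G.Adj i j then 1 else 0) * x j := by
    rw [Finset.sum_comm]
    refine Finset.sum_congr rfl fun i _ => ?_
    rw [← Finset.sum_mul]
    congr 1
    rw [← SimpleGraph.card_neighborFinset_eq_degree, SimpleGraph.neighborFinset_eq_filter]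
    simp [G.adj_comm]
  have h2 : ∑ i, ∑ j, x i * ((if G.Adj i j then 1 else 0) * x j) = 0 := by
    rw [← Finset.sum_product']
    refine Finset.sum_involution (fun p _ => (p.2, p.1)) ?_ ?_ ?_ ?_
    · intro p _
      simp only [G.adj_comm p.2 p.1]
      rw [show x p.2 * ((if G.Adj p.1 p.2 then 1 else 0) * x p.1)
        = x p.1 * ((if G.Adj p.1 p.2 then 1 else 0) * x p.2) by ring]
      exact dbl _
    · rintro ⟨i, j⟩ _ h heq
      simp only [Prod.mk.injEq] at heq
      apply h
      simp [heq.1]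
    · simp
    · simp
  have h3 : ∀ i, ∑ j, (if G.Adj i j then 1 else 0) * x j
      = x i * ∑ j, (if G.Adj i j then 1 else 0) * x j := by
    intro i
    have e := eq_neg_of_add_eq_zero_right (hx i)
    rw [e]
    linear_combination (-d i) * (sq (x i)).symm
  rw [h1]
  refine Eq.trans ?_ h2
  refine Finset.sum_congr rfl fun i _ => ?_
  rw [h3 i, Finset.mul_sum]

/-- Existence of a characteristic-type vector for trees: if `Γ` is a finite tree on
`s` vertices, `M` is the matrix with arbitrary integer diagonal `m i` and off-diagonal
entries `1` exactly at adjacent pairs, and `δ` is the vector of vertex degrees, then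
there exists `b ∈ ℤˢ` with `M b ≡ δ (mod 2)` coordinatewise. -/
theorem exists_characteristic_vector_of_tree (s : ℕ) (G : SimpleGraph (Fin s))
    [DecidableRel G.Adj] (hG : G.IsTree) (m : Fin s → ℤ) :
    ∃ b : Fin s → ℤ, ∀ i : Fin s,
      (2 : ℤ) ∣ (Matrix.mulVec
          (Matrix.of fun i j => if i = j then m i else if G.Adj i j then 1 else 0) b i
        - (G.degree i : ℤ)) := by
  let N : Matrix (Fin s) (Fin s) (ZMod 2) :=
    Matrix.of fun i j => if i = j then (m i : ZMod 2) else if G.Adj i j then 1 else 0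
  have hNs : ∀ i j, N i j = N j i := by
    intro i j
    by_cases h : i = j
    · rw [h]
    · simp [N, h, Ne.symm h, G.adj_comm]
  let φ : Module.Dual (ZMod 2) (Fin s → ZMod 2) :=
    ∑ i, (G.degree i : ZMod 2) • LinearMap.proj i
  have hφ : ∀ x, φ x = ∑ i, (G.degree i : ZMod 2) * x i := by
    intro x; simp [φ]
  have hmem : φ ∈ LinearMap.range (Matrix.toLin' N).dualMap := by
    rw [LinearMap.range_dualMap_eq_dualAnnihilator_ker, Submodule.mem_dualAnnihilator]
    intro x hx
    rw [hφ]
    apply kernel_orthogonal_degree s G (fun i => (m i : ZMod 2)) x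
    intro i
    have h := congrFun (LinearMap.mem_ker.1 hx) i
    rw [Matrix.toLin'_apply] at h
    simp only [Matrix.mulVec, dotProduct, Pi.zero_apply] at h
    refine Eq.trans ?_ h
    have : ∀ j, N i j * x j = (if i = j then (m i : ZMod 2) * x j else 0)
        + (if G.Adj i j then 1 else 0) * x j := by
      intro j
      by_cases hij : i = j
      · subst hij; simp [N]
      · simp [N, hij]
    simp only [this, Finset.sum_add_distrib]
    simp
  obtain ⟨ψ, hψ⟩ := hmem
  refine ⟨fun i => ((ψ (Pi.single i 1)).val : ℤ), fun i => ?_⟩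
  rw [← Nat.cast_ofNat, ← ZMod.intCast_zmod_eq_zero_iff_dvd]
  have h := LinearMap.congr_fun hψ (Pi.single i 1)
  rw [hφ, LinearMap.dualMap_apply, Matrix.toLin'_apply, LinearMap.pi_apply_eq_sum_univ ψ] at h
  simp only [Matrix.mulVec_single_one, Matrix.col_apply] at h
  have h4 : ∑ j, (G.degree j : ZMod 2) * (Pi.single i 1 : Fin s → ZMod 2) j
      = G.degree i := by
    simp [Pi.single_apply]
  rw [h4] at h
  have h5 : ∀ j : Fin s, (fun k => if j = k then (1 : ZMod 2) else 0) = Pi.single j 1 := by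
    intro j; ext k; simp [Pi.single_apply, eq_comm]
  simp only [h5] at h
  push_cast
  rw [← h, sub_eq_zero]
  simp only [Matrix.mulVec, dotProduct, Matrix.of_apply]
  push_cast
  refine Finset.sum_congr rfl fun j _ => ?_
  rw [hNs j i]
  simp [N]
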